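/- Let (𝓜, M, ā) and (𝓝, N, b̄) be pointed systems of the same parameter size and let α be an ordinal. The following are equivalent: (1) Rank(M, ā, N, b̄) ≥ α in the game board MEF(𝓜, 𝓝); (2) (𝓜, M, ā) ↔_α (𝓝, N, b̄); (3) (𝓜, M, ā) and (𝓝, N, b̄) satisfy the same L^◇_∞-formulas of modal-quantifier rank at most α (with the given tuples as parameters). -/

import Mathlib

open FirstOrder Language

namespace Potentialist

/-- The underlying data of a potentialist system: a collection of worlds, each carrying a
first-order `L`-structure. -/
structure PreSys.{u, v, w, x} (L : FirstOrder.Language.{u, v}) where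
  World : Type w
  Dom : World → Type x
  str : ∀ W, L.Structure (Dom W)

attribute [instance] PreSys.str

/-- A potentialist system: a collection of first-order `L`-structures together with a
collection of `L`-embeddings between them, containing all identity embeddings and closed
under composition. -/
structure PotSys.{u, v, w, x} (L : FirstOrder.Language.{u, v})
    extends PreSys.{u, v, w, x} L where
  Emb : ∀ W W' : World, Set (Dom W ↪[L] Dom W')
  id_mem : ∀ W : World, Embedding.refl L (Dom W) ∈ Emb W W
  comp_mem : ∀ {W W' W'' : World} (f : Dom W ↪[L] Dom W') (g : Dom W' ↪[L] Dom W''),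
    f ∈ Emb W W' → g ∈ Emb W' W'' → g.comp f ∈ Emb W W''

/-- Two tuples (in possibly different structures) satisfy the same atomic `L`-formulas. -/
def AtomicEquiv.{u, v, y, z} (L : FirstOrder.Language.{u, v}) {M : Type y} {N : Type z}
    [L.Structure M] [L.Structure N] {n : ℕ} (a : Fin n → M) (b : Fin n → N) : Prop :=
  ∀ φ : L.Formula (Fin n), BoundedFormula.IsAtomic φ → (φ.Realize a ↔ φ.Realize b)

/-- The type of relations between pairs `(M, ā)` and `(N, b̄)` of equal parameter size. -/
abbrev BisimRel.{u, v, w, x, w', x'} {L : FirstOrder.Language.{u, v}}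
    (S : PotSys.{u, v, w, x} L) (T : PotSys.{u, v, w', x'} L) :=
  ∀ (n : ℕ) (M : S.World), (Fin n → S.Dom M) → ∀ N : T.World, (Fin n → T.Dom N) → Prop

/-- `R` is a bisimulation between the potentialist systems `S` and `T`: it is nonempty, and
whenever `R` relates `(M, ā)` to `(N, b̄)`: (B1) `ā` and `b̄` satisfy the same atomic formulas;
(B2) any extension of either tuple by one element can be matched on the other side;
(B3) any embedding on either side can be matched by an embedding on the other side. -/
def IsBisimulation.{u, v, w, x, w', x'} {L : FirstOrder.Language.{u, v}}
    (S : PotSys.{u, v, w, x} L) (T : PotSys.{u, v, w', x'} L) (R : BisimRel S T) : Prop :=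
  (∃ n M a N b, R n M a N b) ∧
  ∀ (n : ℕ) (M : S.World) (a : Fin n → S.Dom M) (N : T.World) (b : Fin n → T.Dom N),
    R n M a N b →
      AtomicEquiv L a b ∧
      (∀ c : S.Dom M, ∃ d : T.Dom N, R (n + 1) M (Fin.snoc a c) N (Fin.snoc b d)) ∧
      (∀ d : T.Dom N, ∃ c : S.Dom M, R (n + 1) M (Fin.snoc a c) N (Fin.snoc b d)) ∧
      (∀ (M' : S.World) (π : S.Dom M ↪[L] S.Dom M'), π ∈ S.Emb M M' →
        ∃ (N' : T.World) (ρ : T.Dom N ↪[L] T.Dom N'), ρ ∈ T.Emb N N' ∧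
          R n M' (fun i => π (a i)) N' (fun i => ρ (b i))) ∧
      (∀ (N' : T.World) (ρ : T.Dom N ↪[L] T.Dom N'), ρ ∈ T.Emb N N' →
        ∃ (M' : S.World) (π : S.Dom M ↪[L] S.Dom M'), π ∈ S.Emb M M' ∧
          R n M' (fun i => π (a i)) N' (fun i => ρ (b i)))

/-- Two pointed systems are bisimilar if some bisimulation relates them. -/
def Bisimilar.{u, v, w, x, w', x'} {L : FirstOrder.Language.{u, v}}
    (S : PotSys.{u, v, w, x} L) (T : PotSys.{u, v, w', x'} L)
    {n : ℕ} (M : S.World) (a : Fin n → S.Dom M) (N : T.World) (b : Fin n → T.Dom N) : Prop :=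
  ∃ R : BisimRel S T, IsBisimulation S T R ∧ R n M a N b

/-- A relation is bitotal if every pair on the left is related to some pair on the right
and vice versa. -/
def Bitotal.{u, v, w, x, w', x'} {L : FirstOrder.Language.{u, v}}
    (S : PotSys.{u, v, w, x} L) (T : PotSys.{u, v, w', x'} L) (R : BisimRel S T) : Prop :=
  (∀ (n : ℕ) (M : S.World) (a : Fin n → S.Dom M), ∃ N b, R n M a N b) ∧
  (∀ (n : ℕ) (N : T.World) (b : Fin n → T.Dom N), ∃ M a, R n M a N b)

/-- Two potentialist systems are bitotally bisimilar if there is a bitotal bisimulation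
between them. -/
def BitotallyBisimilar.{u, v, w, x, w', x'} {L : FirstOrder.Language.{u, v}}
    (S : PotSys.{u, v, w, x} L) (T : PotSys.{u, v, w', x'} L) : Prop :=
  ∃ R : BisimRel S T, IsBisimulation S T R ∧ Bitotal S T R

/-- An iso-bisimulation between potentialist systems: a nonempty relation between worlds
together with a system of isomorphisms, such that embeddings on either side can be matched
by embeddings on the other side, commuting with the isomorphisms. -/
structure IsoBisim.{u, v, w, x, w', x'} {L : FirstOrder.Language.{u, v}}
    (S : PotSys.{u, v, w, x} L) (T : PotSys.{u, v, w', x'} L) where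
  rel : S.World → T.World → Prop
  nonempty : ∃ M N, rel M N
  iso : ∀ {M : S.World} {N : T.World}, rel M N → (S.Dom M ≃[L] T.Dom N)
  forth : ∀ {M : S.World} {N : T.World} (h : rel M N) (M' : S.World)
      (π : S.Dom M ↪[L] S.Dom M'), π ∈ S.Emb M M' →
      ∃ (N' : T.World) (ρ : T.Dom N ↪[L] T.Dom N') (_ : ρ ∈ T.Emb N N') (h' : rel M' N'),
        ∀ y : S.Dom M, iso h' (π y) = ρ (iso h y)
  back : ∀ {M : S.World} {N : T.World} (h : rel M N) (N' : T.World)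
      (ρ : T.Dom N ↪[L] T.Dom N'), ρ ∈ T.Emb N N' →
      ∃ (M' : S.World) (π : S.Dom M ↪[L] S.Dom M') (_ : π ∈ S.Emb M M') (h' : rel M' N'),
        ∀ y : S.Dom M, iso h' (π y) = ρ (iso h y)

/-- An iso-bisimulation is bitotal if every world on either side takes part in the relation. -/
def IsoBisim.Bitotal.{u, v, w, x, w', x'} {L : FirstOrder.Language.{u, v}}
    {S : PotSys.{u, v, w, x} L} {T : PotSys.{u, v, w', x'} L} (I : IsoBisim S T) : Prop :=
  (∀ M : S.World, ∃ N, I.rel M N) ∧ (∀ N : T.World, ∃ M, I.rel M N)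


/-- Formulas of the infinitary modal language `L^◇_∞`, with free variables among `Fin n`:
built from atomic `L`-formulas by negation, conjunctions and disjunctions indexed by an
arbitrary type (so that each formula has only finitely many free variables), quantifiers,
and the modal operators `◇` and `□`. -/
inductive MFormula.{t, u, v} (L : FirstOrder.Language.{u, v}) : ℕ → Type (max u v (t + 1))
  | equal {n : ℕ} (t₁ t₂ : L.Term (Fin n)) : MFormula L n
  | rel {n l : ℕ} (R : L.Relations l) (ts : Fin l → L.Term (Fin n)) : MFormula L n
  | not {n : ℕ} (φ : MFormula L n) : MFormula L n
  | iAll {n : ℕ} {ι : Type t} (φ : ι → MFormula L n) : MFormula L n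
  | iEx {n : ℕ} {ι : Type t} (φ : ι → MFormula L n) : MFormula L n
  | all {n : ℕ} (φ : MFormula L (n + 1)) : MFormula L n
  | ex {n : ℕ} (φ : MFormula L (n + 1)) : MFormula L n
  | box {n : ℕ} (φ : MFormula L n) : MFormula L n
  | dia {n : ℕ} (φ : MFormula L n) : MFormula L n

/-- Satisfaction of an `L^◇_∞`-formula at a world of a potentialist system, with a tuple of
parameters: `◇φ` holds iff `φ` holds at the image of the parameters under some embedding of
the system, and `□φ` holds iff `φ` holds under every such embedding. -/
def Sat.{t, u, v, w, x} {L : FirstOrder.Language.{u, v}} (S : PotSys.{u, v, w, x} L) :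
    {n : ℕ} → (W : S.World) → (Fin n → S.Dom W) → MFormula.{t, u, v} L n → Prop
  | _, _, a, .equal t₁ t₂ => t₁.realize a = t₂.realize a
  | _, _, a, .rel R ts => Structure.RelMap R fun i => (ts i).realize a
  | _, W, a, .not φ => ¬ Sat S W a φ
  | _, W, a, .iAll φ => ∀ i, Sat S W a (φ i)
  | _, W, a, .iEx φ => ∃ i, Sat S W a (φ i)
  | _, W, a, .all φ => ∀ c, Sat S W (Fin.snoc a c) φ
  | _, W, a, .ex φ => ∃ c, Sat S W (Fin.snoc a c) φ
  | _, W, a, .box φ => ∀ (W' : S.World) (π : S.Dom W ↪[L] S.Dom W'),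
      π ∈ S.Emb W W' → Sat S W' (fun i => π (a i)) φ
  | _, W, a, .dia φ => ∃ (W' : S.World) (π : S.Dom W ↪[L] S.Dom W'),
      π ∈ S.Emb W W' ∧ Sat S W' (fun i => π (a i)) φ

/-- The modal-quantifier rank of an `L^◇_∞`-formula: atomic formulas have rank `0`;
negation preserves rank; conjunctions and disjunctions take the supremum of the ranks;
quantifiers and modal operators add `1`. -/
noncomputable def mqrank.{t, u, v} {L : FirstOrder.Language.{u, v}} :
    {n : ℕ} → MFormula.{t, u, v} L n → Ordinal.{t}
  | _, .equal _ _ => 0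
  | _, .rel _ _ => 0
  | _, .not φ => mqrank φ
  | _, .iAll φ => ⨆ i, mqrank (φ i)
  | _, .iEx φ => ⨆ i, mqrank (φ i)
  | _, .all φ => mqrank φ + 1
  | _, .ex φ => mqrank φ + 1
  | _, .box φ => mqrank φ + 1
  | _, .dia φ => mqrank φ + 1

/-- The type of ordinal-indexed families of relations between pairs `(M, ā)` and `(N, b̄)`. -/
abbrev AlphaBisimRel.{r, u, v, w, x, w', x'} {L : FirstOrder.Language.{u, v}}
    (S : PotSys.{u, v, w, x} L) (T : PotSys.{u, v, w', x'} L) :=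
  Ordinal.{r} → ∀ (n : ℕ) (M : S.World), (Fin n → S.Dom M) → ∀ N : T.World, (Fin n → T.Dom N) → Prop

/-- `R` is an `α`-bisimulation between `S` and `T`: a family of nonempty relations `R β`
for `β ≤ α` such that whenever `R β` relates `(M, ā)` to `(N, b̄)`: (αB1) `ā` and `b̄` satisfy
the same atomic formulas; (αB2) for every `γ < β`, any one-element extension of either tuple
can be matched by the other at level `γ`; (αB3) for every `γ < β`, any embedding on either
side can be matched by one on the other side at level `γ`. -/
def IsAlphaBisimulation.{r, u, v, w, x, w', x'} {L : FirstOrder.Language.{u, v}}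
    (S : PotSys.{u, v, w, x} L) (T : PotSys.{u, v, w', x'} L) (α : Ordinal.{r})
    (R : AlphaBisimRel.{r} S T) : Prop :=
  (∀ β ≤ α, ∃ n M a N b, R β n M a N b) ∧
  ∀ β ≤ α, ∀ (n : ℕ) (M : S.World) (a : Fin n → S.Dom M) (N : T.World) (b : Fin n → T.Dom N),
    R β n M a N b →
      AtomicEquiv L a b ∧
      (∀ γ < β, ∀ c : S.Dom M, ∃ d : T.Dom N,
        R γ (n + 1) M (Fin.snoc a c) N (Fin.snoc b d)) ∧
      (∀ γ < β, ∀ d : T.Dom N, ∃ c : S.Dom M,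
        R γ (n + 1) M (Fin.snoc a c) N (Fin.snoc b d)) ∧
      (∀ γ < β, ∀ (M' : S.World) (π : S.Dom M ↪[L] S.Dom M'), π ∈ S.Emb M M' →
        ∃ (N' : T.World) (ρ : T.Dom N ↪[L] T.Dom N'), ρ ∈ T.Emb N N' ∧
          R γ n M' (fun i => π (a i)) N' (fun i => ρ (b i))) ∧
      (∀ γ < β, ∀ (N' : T.World) (ρ : T.Dom N ↪[L] T.Dom N'), ρ ∈ T.Emb N N' →
        ∃ (M' : S.World) (π : S.Dom M ↪[L] S.Dom M'), π ∈ S.Emb M M' ∧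
          R γ n M' (fun i => π (a i)) N' (fun i => ρ (b i)))

/-- Two pointed systems are `α`-bisimilar if some `α`-bisimulation relates them at level `α`. -/
def AlphaBisimilar.{r, u, v, w, x, w', x'} {L : FirstOrder.Language.{u, v}}
    (S : PotSys.{u, v, w, x} L) (T : PotSys.{u, v, w', x'} L) (α : Ordinal.{r})
    {n : ℕ} (M : S.World) (a : Fin n → S.Dom M) (N : T.World) (b : Fin n → T.Dom N) : Prop :=
  ∃ R : AlphaBisimRel.{r} S T, IsAlphaBisimulation S T α R ∧ R α n M a N b

/-- `RankGE S T α n M a N b` expresses that the position `(M, ā, N, b̄)` of the modal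
Ehrenfeucht–Fraïssé game board between `S` and `T` has rank at least `α`: the tuples satisfy
the same atomic formulas, and for every `β < α`, every move of Abelard from this position
(choosing an element on either side, or an embedding on either side) can be answered by
Eloise reaching a position of rank at least `β`. -/
def RankGE.{r, u, v, w, x, w', x'} {L : FirstOrder.Language.{u, v}}
    (S : PotSys.{u, v, w, x} L) (T : PotSys.{u, v, w', x'} L) (α : Ordinal.{r})
    (n : ℕ) (M : S.World) (a : Fin n → S.Dom M) (N : T.World) (b : Fin n → T.Dom N) : Prop :=
  AtomicEquiv L a b ∧
  ∀ β < α,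
    (∀ c : S.Dom M, ∃ d : T.Dom N,
      RankGE S T β (n + 1) M (Fin.snoc a c) N (Fin.snoc b d)) ∧
    (∀ d : T.Dom N, ∃ c : S.Dom M,
      RankGE S T β (n + 1) M (Fin.snoc a c) N (Fin.snoc b d)) ∧
    (∀ (M' : S.World) (π : S.Dom M ↪[L] S.Dom M'), π ∈ S.Emb M M' →
      ∃ (N' : T.World) (ρ : T.Dom N ↪[L] T.Dom N'), ρ ∈ T.Emb N N' ∧
        RankGE S T β n M' (fun i => π (a i)) N' (fun i => ρ (b i))) ∧
    (∀ (N' : T.World) (ρ : T.Dom N ↪[L] T.Dom N'), ρ ∈ T.Emb N N' →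
      ∃ (M' : S.World) (π : S.Dom M ↪[L] S.Dom M'), π ∈ S.Emb M M' ∧
        RankGE S T β n M' (fun i => π (a i)) N' (fun i => ρ (b i)))
termination_by α


section

universe t r u v w x w' x'

variable {L : FirstOrder.Language.{u, v}}

theorem realize_relabel_sumElim_id {M : Type x} [L.Structure M] {n : ℕ} (a : Fin n → M)
    (d : Fin 0 → M) (t : L.Term (Fin n ⊕ Fin 0)) :
    (t.relabel (Sum.elim id Fin.elim0)).realize a = t.realize (Sum.elim a d) := by
  rw [Term.realize_relabel]
  congr 1
  ext (_ | i)
  · rfl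
  · exact i.elim0

theorem atomicEquiv_iff {M : Type x} {N : Type x'} [L.Structure M] [L.Structure N] {n : ℕ}
    {a : Fin n → M} {b : Fin n → N} :
    AtomicEquiv L a b ↔
      (∀ t₁ t₂ : L.Term (Fin n), t₁.realize a = t₂.realize a ↔ t₁.realize b = t₂.realize b) ∧
      ∀ (l : ℕ) (R : L.Relations l) (ts : Fin l → L.Term (Fin n)),
        (Structure.RelMap R fun i => (ts i).realize a) ↔
          Structure.RelMap R fun i => (ts i).realize b := by
  refine ⟨fun h => ⟨fun t₁ t₂ => ?_, fun l R ts => ?_⟩, fun ⟨heq, hrel⟩ φ hφ => ?_⟩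
  · simpa using h (t₁.equal t₂) (.equal _ _)
  · simpa [Formula.realize_rel] using h (R.formula ts) (.rel _ _)
  · cases hφ with
    | equal t₁ t₂ =>
      have h := heq (t₁.relabel (Sum.elim id Fin.elim0)) (t₂.relabel (Sum.elim id Fin.elim0))
      simp only [realize_relabel_sumElim_id _ default] at h
      exact h
    | rel R ts =>
      have h := hrel _ R fun i => (ts i).relabel (Sum.elim id Fin.elim0)
      simp only [realize_relabel_sumElim_id _ default] at h
      exact h

theorem RankGE.mono {S : PotSys.{u, v, w, x} L} {T : PotSys.{u, v, w', x'} L}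
    {α β : Ordinal.{r}} (hβ : β ≤ α) {n : ℕ} {M : S.World} {a : Fin n → S.Dom M} {N : T.World}
    {b : Fin n → T.Dom N} (h : RankGE S T α n M a N b) : RankGE S T β n M a N b := by
  rw [RankGE] at h ⊢
  exact ⟨h.1, fun γ hγ => h.2 γ (hγ.trans_le hβ)⟩

theorem rankGE_iff_alphaBisimilar {S : PotSys.{u, v, w, x} L} {T : PotSys.{u, v, w', x'} L}
    {α : Ordinal.{r}} {n : ℕ} {M : S.World} {a : Fin n → S.Dom M} {N : T.World}
    {b : Fin n → T.Dom N} : RankGE S T α n M a N b ↔ AlphaBisimilar S T α M a N b := by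
  constructor
  · refine fun h => ⟨RankGE S T, ⟨fun β hβ => ⟨n, M, a, N, b, h.mono hβ⟩, ?_⟩, h⟩
    intro β _ n M a N b h
    rw [RankGE] at h
    exact ⟨h.1, fun γ hγ => (h.2 γ hγ).1, fun γ hγ => (h.2 γ hγ).2.1,
      fun γ hγ => (h.2 γ hγ).2.2.1, fun γ hγ => (h.2 γ hγ).2.2.2⟩
  · rintro ⟨R, ⟨-, hR⟩, h⟩
    suffices ∀ β ≤ α, ∀ n M a N b, R β n M a N b → RankGE S T β n M a N b from
      this α le_rfl _ _ _ _ _ h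
    intro β
    induction β using WellFoundedLT.induction with
    | ind β ih =>
      intro hβ n M a N b h
      obtain ⟨hat, hl, hr, hl', hr'⟩ := hR β hβ n M a N b h
      rw [RankGE]
      refine ⟨hat, fun γ hγ => ?_⟩
      have ih := ih γ hγ (hγ.le.trans hβ)
      refine ⟨fun c => (hl γ hγ c).imp fun _ => ih _ _ _ _ _,
        fun d => (hr γ hγ d).imp fun _ => ih _ _ _ _ _, fun M' π hπ => ?_, fun N' ρ hρ => ?_⟩
      · obtain ⟨N', ρ, hρ, h⟩ := hl' γ hγ M' π hπ
        exact ⟨N', ρ, hρ, ih _ _ _ _ _ h⟩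
      · obtain ⟨M', π, hπ, h⟩ := hr' γ hγ N' ρ hρ
        exact ⟨M', π, hπ, ih _ _ _ _ _ h⟩

theorem mqrank_le_iSup {n : ℕ} {ι : Type t} (φ : ι → MFormula.{t, u, v} L n) (i : ι) :
    mqrank (φ i) ≤ ⨆ i, mqrank (φ i) :=
  Ordinal.le_iSup (fun i => mqrank (φ i)) i

theorem RankGE.sat_iff {S : PotSys.{u, v, w, x} L} {T : PotSys.{u, v, w', x'} L} {n : ℕ}
    (φ : MFormula.{t, u, v} L n) {α : Ordinal.{t}} {M : S.World} {a : Fin n → S.Dom M}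
    {N : T.World} {b : Fin n → T.Dom N} (h : RankGE S T α n M a N b) (hφ : mqrank φ ≤ α) :
    Sat S M a φ ↔ Sat T N b φ := by
  induction φ generalizing α M N with
  | equal t₁ t₂ =>
    rw [RankGE, atomicEquiv_iff] at h
    exact h.1.1 t₁ t₂
  | rel R ts =>
    rw [RankGE, atomicEquiv_iff] at h
    exact h.1.2 _ R ts
  | not φ ih => exact not_congr (ih h hφ)
  | iAll φ ih => exact forall_congr' fun i => ih i h ((mqrank_le_iSup φ i).trans hφ)
  | iEx φ ih => exact exists_congr fun i => ih i h ((mqrank_le_iSup φ i).trans hφ)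
  | all φ ih =>
    rw [RankGE] at h
    obtain ⟨hl, hr, -⟩ := h.2 _ (Order.add_one_le_iff.1 hφ)
    constructor
    · intro hs d
      obtain ⟨c, hc⟩ := hr d
      exact (ih hc le_rfl).1 (hs c)
    · intro hs c
      obtain ⟨d, hd⟩ := hl c
      exact (ih hd le_rfl).2 (hs d)
  | ex φ ih =>
    rw [RankGE] at h
    obtain ⟨hl, hr, -⟩ := h.2 _ (Order.add_one_le_iff.1 hφ)
    constructor
    · rintro ⟨c, hs⟩
      obtain ⟨d, hd⟩ := hl c
      exact ⟨d, (ih hd le_rfl).1 hs⟩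
    · rintro ⟨d, hs⟩
      obtain ⟨c, hc⟩ := hr d
      exact ⟨c, (ih hc le_rfl).2 hs⟩
  | box φ ih =>
    rw [RankGE] at h
    obtain ⟨-, -, hl, hr⟩ := h.2 _ (Order.add_one_le_iff.1 hφ)
    constructor
    · intro hs N' ρ hρ
      obtain ⟨M', π, hπ, h⟩ := hr N' ρ hρ
      exact (ih h le_rfl).1 (hs M' π hπ)
    · intro hs M' π hπ
      obtain ⟨N', ρ, hρ, h⟩ := hl M' π hπ
      exact (ih h le_rfl).2 (hs N' ρ hρ)
  | dia φ ih =>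
    rw [RankGE] at h
    obtain ⟨-, -, hl, hr⟩ := h.2 _ (Order.add_one_le_iff.1 hφ)
    constructor
    · rintro ⟨M', π, hπ, hs⟩
      obtain ⟨N', ρ, hρ, h⟩ := hl M' π hπ
      exact ⟨N', ρ, hρ, (ih h le_rfl).1 hs⟩
    · rintro ⟨N', ρ, hρ, hs⟩
      obtain ⟨M', π, hπ, h⟩ := hr N' ρ hρ
      exact ⟨M', π, hπ, (ih h le_rfl).2 hs⟩

open Classical in
/-- The formula asserting that, among the formulas in `F`, exactly those in `s` hold. -/
noncomputable def MFormula.description {n : ℕ} (F : Set (MFormula.{t, u, v} L n)) [Small.{t} F]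
    (s : Set F) : MFormula.{t, u, v} L n :=
  .iAll fun i : Shrink.{t} F =>
    if (equivShrink F).symm i ∈ s then ((equivShrink F).symm i).1
    else .not ((equivShrink F).symm i).1

theorem mqrank_description_le {n : ℕ} {F : Set (MFormula.{t, u, v} L n)} [Small.{t} F]
    {β : Ordinal.{t}} (hF : ∀ φ ∈ F, mqrank φ ≤ β) (s : Set F) :
    mqrank (MFormula.description F s) ≤ β := by
  rw [MFormula.description, mqrank]
  refine Ordinal.iSup_le fun i => ?_
  split_ifs
  · exact hF _ (Subtype.property _)
  · exact hF ((equivShrink F).symm i).1 (Subtype.property _)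

theorem sat_description {S : PotSys.{u, v, w, x} L} {n : ℕ} {F : Set (MFormula.{t, u, v} L n)}
    [Small.{t} F] {s : Set F} {M : S.World} {a : Fin n → S.Dom M} :
    Sat S M a (MFormula.description F s) ↔ ∀ φ : F, Sat S M a φ.1 ↔ φ ∈ s := by
  rw [MFormula.description, Sat, (equivShrink F).symm.forall_congr_left]
  refine forall_congr' fun φ => ?_
  by_cases h : φ ∈ s <;> simp [h, Sat]

theorem sat_description_self {S : PotSys.{u, v, w, x} L} {n : ℕ}
    (F : Set (MFormula.{t, u, v} L n)) [Small.{t} F] (M : S.World) (a : Fin n → S.Dom M) :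
    Sat S M a (MFormula.description F {φ | Sat S M a φ.1}) :=
  sat_description.2 fun _ => Iff.rfl

/-- For each `α`, a small set of formulas of modal-quantifier rank at most `α` suffices to
detect rank at least `α` in the game board. -/
theorem exists_small_set_rankGE [∀ n, Small.{t} (L.Term (Fin n))]
    [∀ l, Small.{t} (L.Relations l)] (S : PotSys.{u, v, w, x} L) (T : PotSys.{u, v, w', x'} L)
    (α : Ordinal.{t}) (n : ℕ) :
    ∃ F : Set (MFormula.{t, u, v} L n), Small.{t} F ∧ (∀ φ ∈ F, mqrank φ ≤ α) ∧
      ∀ (M : S.World) (a : Fin n → S.Dom M) (N : T.World) (b : Fin n → T.Dom N),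
        (∀ φ ∈ F, Sat S M a φ ↔ Sat T N b φ) → RankGE S T α n M a N b := by
  induction α using WellFoundedLT.induction generalizing n with
  | ind α ih =>
    choose F hsmall hrank hF using fun (β : Set.Iio α) (m : ℕ) => ih β.1 β.2 m
    have := hsmall
    have hsat {β : Set.Iio α} {m : ℕ} {M : S.World} {a : Fin m → S.Dom M} {N : T.World}
        {b : Fin m → T.Dom N} {s : Set (F β m)} (hM : Sat S M a (.description _ s))
        (hN : Sat T N b (.description _ s)) : RankGE S T β.1 m M a N b :=
      hF β m M a N b fun φ hφ =>
        (sat_description.1 hM ⟨φ, hφ⟩).trans (sat_description.1 hN ⟨φ, hφ⟩).symm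
    have hex (β : Set.Iio α) (s : Set (F β (n + 1))) :
        mqrank (.ex (.description (F β (n + 1)) s)) ≤ α :=
      Order.add_one_le_iff.2 ((mqrank_description_le (hrank β _) s).trans_lt β.2)
    have hdia (β : Set.Iio α) (s : Set (F β n)) :
        mqrank (.dia (.description (F β n) s)) ≤ α :=
      Order.add_one_le_iff.2 ((mqrank_description_le (hrank β _) s).trans_lt β.2)
    refine ⟨Set.range (fun p : L.Term (Fin n) × L.Term (Fin n) => .equal p.1 p.2) ∪
      Set.range (fun p : Σ l, L.Relations l × (Fin l → L.Term (Fin n)) => .rel p.2.1 p.2.2) ∪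
      Set.range (fun p : Σ β, Set (F β (n + 1)) => .ex (.description (F p.1 (n + 1)) p.2)) ∪
      Set.range (fun p : Σ β, Set (F β n) => .dia (.description (F p.1 n) p.2)), ?_, ?_, ?_⟩
    · infer_instance
    · rintro _ (((⟨p, rfl⟩ | ⟨p, rfl⟩) | ⟨p, rfl⟩) | ⟨p, rfl⟩)
      · exact zero_le
      · exact zero_le
      · exact hex p.1 p.2
      · exact hdia p.1 p.2
    · intro M a N b h
      rw [RankGE, atomicEquiv_iff]
      refine ⟨⟨fun t₁ t₂ => h _ (.inl (.inl (.inl ⟨(t₁, t₂), rfl⟩))),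
        fun l R ts => h _ (.inl (.inl (.inr ⟨⟨l, R, ts⟩, rfl⟩)))⟩, fun β hβ => ?_⟩
      have hex (s) := h _ (.inl (.inr ⟨⟨⟨β, hβ⟩, s⟩, rfl⟩))
      have hdia (s) := h _ (.inr ⟨⟨⟨β, hβ⟩, s⟩, rfl⟩)
      simp only [Sat] at hex hdia
      refine ⟨fun c => ?_, fun d => ?_, fun M' π hπ => ?_, fun N' ρ hρ => ?_⟩
      · have hc := sat_description_self (F ⟨β, hβ⟩ (n + 1)) M (Fin.snoc a c)
        obtain ⟨d, hd⟩ := (hex _).1 ⟨c, hc⟩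
        exact ⟨d, hsat hc hd⟩
      · have hd := sat_description_self (F ⟨β, hβ⟩ (n + 1)) N (Fin.snoc b d)
        obtain ⟨c, hc⟩ := (hex _).2 ⟨d, hd⟩
        exact ⟨c, hsat hc hd⟩
      · have hM := sat_description_self (F ⟨β, hβ⟩ n) M' fun i => π (a i)
        obtain ⟨N', ρ, hρ, hN⟩ := (hdia _).1 ⟨M', π, hπ, hM⟩
        exact ⟨N', ρ, hρ, hsat hM hN⟩
      · have hN := sat_description_self (F ⟨β, hβ⟩ n) N' fun i => ρ (b i)
        obtain ⟨M', π, hπ, hM⟩ := (hdia _).2 ⟨N', ρ, hρ, hN⟩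
        exact ⟨M', π, hπ, hsat hM hN⟩

end

/-- for pointed systems `(𝓜, M, ā)` and `(𝓝, N, b̄)` of the same parameter
size and any ordinal `α`, the following are equivalent: (1) the position `(M, ā, N, b̄)` has
rank at least `α` in the game board `MEF(𝓜, 𝓝)`; (2) `(𝓜, M, ā) ↔_α (𝓝, N, b̄)`;
(3) the two pointed systems satisfy the same `L^◇_∞`-formulas of modal-quantifier rank at
most `α`. -/
theorem rankGE_alphaBisimilar_elementarilyEquivalent_iff.{u, v, w, x, w', x'}
    {L : FirstOrder.Language.{u, v}}
    (S : PotSys.{u, v, w, x} L) (T : PotSys.{u, v, w', x'} L)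
    {n : ℕ} (M : S.World) (a : Fin n → S.Dom M) (N : T.World) (b : Fin n → T.Dom N)
    (α : Ordinal.{max u v x x'}) :
    (RankGE S T α n M a N b ↔ AlphaBisimilar S T α M a N b) ∧
    (RankGE S T α n M a N b ↔
      ∀ φ : MFormula.{max u v x x', u, v} L n, mqrank φ ≤ α →
        (Sat S M a φ ↔ Sat T N b φ)) := by
  refine ⟨rankGE_iff_alphaBisimilar, fun h φ hφ => h.sat_iff φ hφ, fun h => ?_⟩
  have (m : ℕ) : Small.{max u v x x'} (L.Term (Fin m)) := small_lift.{u, max v x x'} _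
  have (l : ℕ) : Small.{max u v x x'} (L.Relations l) := small_lift.{v, max u x x'} _
  obtain ⟨F, -, hrank, hF⟩ := exists_small_set_rankGE S T α n
  exact hF M a N b fun φ hφ => h φ (hrank φ hφ)

end Potentialist
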